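/- Let m ≥ 1. Let K be a finite subset of Sp_{2m}(ℝ) ∩ O_{2m}(ℝ) such that the subgroup of Sp_{2m}(ℝ) ∩ O_{2m}(ℝ) generated by K is dense in Sp_{2m}(ℝ) ∩ O_{2m}(ℝ). Let S ∈ Sp_{2m}(ℝ) be a symplectic matrix that is not orthogonal. Then the subgroup of Sp_{2m}(ℝ) generated by K ∪ {S} is dense in Sp_{2m}(ℝ). -/

import Mathlib

open Matrix

/-- The standard symplectic form `Ω`, the direct sum of `m` copies of `[[0,1],[-1,0]]`. -/
noncomputable def symplecticForm (m : ℕ) : Matrix (Fin 2 × Fin m) (Fin 2 × Fin m) ℝ :=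
  Matrix.blockDiagonal fun _ => !![0, 1; -1, 0]

/-- `S ∈ Sp_{2m}(ℝ)`, i.e. `S Ω Sᵀ = Ω`. -/
def IsSymplectic {m : ℕ} (S : Matrix (Fin 2 × Fin m) (Fin 2 × Fin m) ℝ) : Prop :=
  S * symplecticForm m * Sᵀ = symplecticForm m

section helpers

abbrev Mt (m : ℕ) := Matrix (Fin 2 × Fin m) (Fin 2 × Fin m) ℝ

lemma exists_eig {n : Type*} [Fintype n] [DecidableEq n] (P : Matrix n n ℝ) (hP : Pᵀ = P)
    {ι : Type*} [Fintype ι] (w : ι → n → ℝ) (hw : ∀ j, ∃ c : ℝ, P *ᵥ w j = c • w j)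
    (hc : Fintype.card ι < Fintype.card n) :
    ∃ v : n → ℝ, v ⬝ᵥ v = 1 ∧ (∀ j, w j ⬝ᵥ v = 0) ∧ ∃ c : ℝ, P *ᵥ v = c • v := by
  let L : EuclideanSpace ℝ n →ₗ[ℝ] EuclideanSpace ℝ n := Matrix.toEuclideanLin P
  have hL : L.IsSymmetric := by
    rw [Matrix.isSymmetric_toEuclideanLin_iff, Matrix.IsHermitian, Matrix.conjTranspose_eq_transpose_of_trivial]
    exact hP
  let W : Submodule ℝ (EuclideanSpace ℝ n) :=
    (Submodule.span ℝ (Set.range fun j => WithLp.toLp 2 (w j)))ᗮ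
  have hin : ∀ (x y : EuclideanSpace ℝ n), inner ℝ x y = x.ofLp ⬝ᵥ y.ofLp := by
    intro x y
    simp [EuclideanSpace.inner_eq_star_dotProduct, dotProduct_comm]
  have hmem : ∀ v : EuclideanSpace ℝ n, v ∈ W ↔ ∀ j, w j ⬝ᵥ v.ofLp = 0 := by
    intro v
    constructor
    · intro h j
      have := (Submodule.mem_orthogonal _ _).1 h _ (Submodule.subset_span ⟨j, rfl⟩)
      simpa [hin] using this
    · intro h
      refine (Submodule.mem_orthogonal _ _).2 fun u hu => ?_
      induction hu using Submodule.span_induction with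
      | mem x hx => obtain ⟨j, rfl⟩ := hx; simpa [hin] using h j
      | zero => simp
      | add x y _ _ hx hy => simp [inner_add_left, hx, hy]
      | smul a x _ hx => simp [inner_smul_left, hx]
  have hinv : ∀ v ∈ W, L v ∈ W := by
    intro v hv
    rw [hmem] at hv ⊢
    intro j
    obtain ⟨c, hc⟩ := hw j
    have : (L v).ofLp = P *ᵥ v.ofLp := by simp [L, Matrix.toEuclideanLin]
    rw [this, Matrix.dotProduct_mulVec, ← Matrix.mulVec_transpose, hP, hc, smul_dotProduct, hv j]
    simp
  have hnt : Nontrivial W := by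
    rw [← Module.finrank_pos_iff (R := ℝ)]
    have h1 := Submodule.finrank_add_finrank_orthogonal
      (Submodule.span ℝ (Set.range fun j => (WithLp.toLp 2 (w j) : EuclideanSpace ℝ n)))
    have h2 := finrank_range_le_card (R := ℝ) fun j => (WithLp.toLp 2 (w j) : EuclideanSpace ℝ n)
    rw [Set.finrank] at h2
    rw [finrank_euclideanSpace] at h1
    change 0 < Module.finrank ℝ (Submodule.span ℝ (Set.range fun j => (WithLp.toLp 2 (w j) : EuclideanSpace ℝ n)))ᗮ
    omega
  have hLW := hL.restrict_invariant hinv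
  obtain ⟨v, hv⟩ := hLW.hasEigenvalue_iSup_of_finiteDimensional.exists_hasEigenvector
  generalize (⨆ x : {x : W // x ≠ 0}, _ : ℝ) = c at hv
  have hv0 : (v : EuclideanSpace ℝ n) ≠ 0 := by simpa using hv.2
  have hvc : L v = c • (v : EuclideanSpace ℝ n) := by
    have := congrArg Subtype.val hv.apply_eq_smul
    simpa using this
  have hvc' : P *ᵥ (v : EuclideanSpace ℝ n).ofLp = c • (v : EuclideanSpace ℝ n).ofLp := by
    have := congrArg WithLp.ofLp hvc
    simpa [L, Matrix.toEuclideanLin] using this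
  have hn : ‖(v : EuclideanSpace ℝ n)‖ ≠ 0 := by simpa using hv0
  have hnn : (v : EuclideanSpace ℝ n).ofLp ⬝ᵥ (v : EuclideanSpace ℝ n).ofLp
      = ‖(v : EuclideanSpace ℝ n)‖ ^ 2 := by
    rw [← hin, real_inner_self_eq_norm_sq]
  refine ⟨‖(v : EuclideanSpace ℝ n)‖⁻¹ • (v : EuclideanSpace ℝ n).ofLp, ?_, ?_, c, ?_⟩
  · rw [smul_dotProduct, dotProduct_smul, hnn]
    simp only [smul_eq_mul]
    field_simp
  · intro j
    rw [dotProduct_smul, (hmem _).1 v.2 j, smul_zero]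
  · rw [mulVec_smul, hvc', smul_comm]

lemma omega_transpose (m : ℕ) : (symplecticForm m)ᵀ = -symplecticForm m := by
  rw [symplecticForm, ← blockDiagonal_neg, blockDiagonal_transpose]
  congr 1; funext k; ext i j; fin_cases i <;> fin_cases j <;> simp

lemma omega_apply (m : ℕ) (i i' j j') : symplecticForm m (i, j) (i', j') =
    if j = j' then (!![0, 1; -1, 0] : Matrix (Fin 2) (Fin 2) ℝ) i i' else 0 := by
  rw [symplecticForm, blockDiagonal_apply]

lemma omega_sq (m : ℕ) : symplecticForm m * symplecticForm m = -1 := by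
  rw [symplecticForm, ← blockDiagonal_one, ← blockDiagonal_neg, ← blockDiagonal_mul]
  congr 1; funext k; ext i j; fin_cases i <;> fin_cases j <;> simp

lemma IsSymplectic.tr {m : ℕ} {S : Mt m} (h : IsSymplectic S) : IsSymplectic Sᵀ := by
  unfold IsSymplectic at *
  have h1 : S * (-(symplecticForm m * Sᵀ * symplecticForm m)) = 1 := by
    calc _ = -((S * symplecticForm m * Sᵀ) * symplecticForm m) := by
            simp only [mul_neg, Matrix.mul_assoc]
      _ = 1 := by rw [h, omega_sq, neg_neg]
  have h2 := mul_eq_one_comm.1 h1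
  calc Sᵀ * symplecticForm m * Sᵀᵀ
      = -(symplecticForm m * symplecticForm m) * (Sᵀ * symplecticForm m * S) := by
        rw [omega_sq]; simp
    _ = symplecticForm m * (-(symplecticForm m * Sᵀ * symplecticForm m) * S) := by
        simp only [neg_mul, mul_neg, Matrix.mul_assoc]
    _ = _ := by rw [h2, Matrix.mul_one]

lemma IsSymplectic.mul {m : ℕ} {S T : Mt m} (h : IsSymplectic S) (h' : IsSymplectic T) :
    IsSymplectic (S * T) := by
  unfold IsSymplectic at *
  calc _ = S * (T * symplecticForm m * Tᵀ) * Sᵀ := by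
        rw [transpose_mul]; simp only [Matrix.mul_assoc]
    _ = _ := by rw [h', h]

lemma exists_frame {m : ℕ} (P : Mt m) (hP : Pᵀ = P) (hs : IsSymplectic P) (k : ℕ) (hk : k ≤ m) :
    ∃ (e : Fin k → (Fin 2 × Fin m → ℝ)) (c : Fin k → ℝ),
      (∀ i j, e i ⬝ᵥ e j = if i = j then 1 else 0) ∧
      (∀ i j, e i ⬝ᵥ (symplecticForm m *ᵥ e j) = 0) ∧
      (∀ i, P *ᵥ e i = c i • e i) ∧
      (∀ i, c i ≠ 0 ∧ P *ᵥ (symplecticForm m *ᵥ e i) = (c i)⁻¹ • (symplecticForm m *ᵥ e i)) := by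
  have hskew : ∀ a b : Fin 2 × Fin m → ℝ,
      a ⬝ᵥ (symplecticForm m *ᵥ b) = - (b ⬝ᵥ (symplecticForm m *ᵥ a)) := by
    intro a b
    rw [dotProduct_mulVec, ← mulVec_transpose, omega_transpose, neg_mulVec, neg_dotProduct,
      dotProduct_comm]
  induction k with
  | zero => exact ⟨Fin.elim0, Fin.elim0, fun i => i.elim0, fun i => i.elim0, fun i => i.elim0,
      fun i => i.elim0⟩
  | succ k ih =>
    obtain ⟨e, c, h1, h2, h3, h4⟩ := ih (by omega)
    obtain ⟨v, hv1, hv2, d, hd⟩ := exists_eig P hP (ι := Fin k ⊕ Fin k)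
      (Sum.elim e (fun i => symplecticForm m *ᵥ e i))
      (by
        rintro (j | j)
        · exact ⟨_, h3 j⟩
        · exact ⟨_, (h4 j).2⟩)
      (by simp; omega)
    have ha : ∀ j, e j ⬝ᵥ v = 0 := fun j => hv2 (Sum.inl j)
    have hb : ∀ j, v ⬝ᵥ (symplecticForm m *ᵥ e j) = 0 := fun j => by
      rw [dotProduct_comm]; exact hv2 (Sum.inr j)
    have hself : v ⬝ᵥ (symplecticForm m *ᵥ v) = 0 := by
      have := hskew v v; linarith
    have hO : d • (P *ᵥ (symplecticForm m *ᵥ v)) = symplecticForm m *ᵥ v := by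
      rw [← mulVec_smul, ← mulVec_smul, ← hd, mulVec_mulVec, mulVec_mulVec]
      have : P * symplecticForm m * P = symplecticForm m := by
        unfold IsSymplectic at hs; rwa [hP] at hs
      rw [this]
    have hd0 : d ≠ 0 := by
      rintro rfl
      rw [zero_smul] at hO
      have : symplecticForm m *ᵥ (symplecticForm m *ᵥ v) = 0 := by rw [← hO, mulVec_zero]
      rw [mulVec_mulVec, omega_sq, neg_mulVec, one_mulVec, neg_eq_zero] at this
      rw [this] at hv1
      simp at hv1
    refine ⟨Fin.cons v e, Fin.cons d c, ?_, ?_, ?_, ?_⟩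
    · intro i j
      refine Fin.cases ?_ (fun i => ?_) i <;> refine Fin.cases ?_ (fun j => ?_) j
      · simpa using hv1
      · simpa [dotProduct_comm, (Fin.succ_ne_zero j).symm] using ha j
      · simpa using ha i
      · simpa using h1 i j
    · intro i j
      refine Fin.cases ?_ (fun i => ?_) i <;> refine Fin.cases ?_ (fun j => ?_) j
      · simpa using hself
      · simpa using hb j
      · simp only [Fin.cons_succ, Fin.cons_zero]
        rw [hskew, hb, neg_zero]
      · simpa using h2 i j
    · intro i
      refine Fin.cases ?_ (fun i => ?_) i
      · simpa using hd
      · simpa using h3 i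
    · intro i
      refine Fin.cases ?_ (fun i => ?_) i
      · refine ⟨by simpa using hd0, ?_⟩
        simp only [Fin.cons_zero]
        rw [eq_inv_smul_iff₀ hd0, hO]
      · simpa using h4 i

/-- squeezer -/
noncomputable def sqz (d : ℝ) : Matrix (Fin 2) (Fin 2) ℝ := !![d, 0; 0, d⁻¹]

lemma isSymplectic_bd {m : ℕ} (A : Fin m → Matrix (Fin 2) (Fin 2) ℝ) (h : ∀ k, (A k).det = 1) :
    IsSymplectic (blockDiagonal A) := by
  unfold IsSymplectic symplecticForm
  rw [blockDiagonal_transpose, ← blockDiagonal_mul, ← blockDiagonal_mul]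
  congr 1; funext k
  have := h k
  rw [det_fin_two] at this
  ext i j
  fin_cases i <;> fin_cases j <;> simp [Matrix.mul_apply, Fin.sum_univ_two] <;> linarith

lemma orth_bd {m : ℕ} (A : Fin m → Matrix (Fin 2) (Fin 2) ℝ) (h : ∀ k, A k * (A k)ᵀ = 1) :
    (blockDiagonal A) * (blockDiagonal A)ᵀ = 1 := by
  rw [blockDiagonal_transpose, ← blockDiagonal_mul, ← blockDiagonal_one]
  congr 1; funext k; exact h k

lemma exists_diag {m : ℕ} (P : Mt m) (hP : Pᵀ = P) (hs : IsSymplectic P) :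
    ∃ (U : Mt m) (c : Fin m → ℝ), (∀ k, c k ≠ 0) ∧ IsSymplectic U ∧ U * Uᵀ = 1 ∧
      U * P * Uᵀ = blockDiagonal (fun k => sqz (c k)) := by
  obtain ⟨e, c, h1, h2, h3, h4⟩ := exists_frame P hP hs m le_rfl
  let f : Fin 2 × Fin m → (Fin 2 × Fin m → ℝ) := fun p =>
    if p.1 = 0 then e p.2 else -(symplecticForm m *ᵥ e p.2)
  let U : Mt m := Matrix.of f
  have key : ∀ (M : Mt m) p q, (U * M * Uᵀ) p q = f p ⬝ᵥ (M *ᵥ f q) := by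
    intro M p q
    rw [Matrix.mul_assoc, Matrix.mul_apply, dotProduct]
    refine Finset.sum_congr rfl fun r _ => ?_
    rw [Matrix.mul_apply]; rfl
  have hsk : ∀ a b : Fin 2 × Fin m → ℝ,
      (symplecticForm m *ᵥ a) ⬝ᵥ b = - (a ⬝ᵥ (symplecticForm m *ᵥ b)) := by
    intro a b
    rw [dotProduct_mulVec, ← mulVec_transpose, omega_transpose, neg_mulVec, neg_dotProduct, neg_neg]
  have hsq : ∀ a, symplecticForm m *ᵥ (symplecticForm m *ᵥ a) = -a := by
    intro a; rw [mulVec_mulVec, omega_sq, neg_mulVec, one_mulVec]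
  refine ⟨U, c, fun k => (h4 k).1, ?_, ?_, ?_⟩
  · ext ⟨i, j⟩ ⟨i', j'⟩
    rw [key, omega_apply]
    fin_cases i <;> fin_cases i' <;>
      simp [f, mulVec_neg, hsk, hsq, h1, h2]
    split_ifs <;> simp
  · have : U * Uᵀ = U * 1 * Uᵀ := by rw [Matrix.mul_one]
    rw [this]
    ext ⟨i, j⟩ ⟨i', j'⟩
    rw [key]
    fin_cases i <;> fin_cases i' <;>
      simp [f, Matrix.one_apply, hsk, hsq, h1, h2]
  · ext ⟨i, j⟩ ⟨i', j'⟩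
    rw [key]
    fin_cases i <;> fin_cases i' <;>
      simp [f, sqz, blockDiagonal_apply, mulVec_neg, h3, (h4 _).2, hsk, hsq, h1, h2]
    all_goals
      split_ifs with hjj
      · rw [hjj]
      · rfl

lemma sqz_mul (a b : ℝ) : sqz a * sqz b = sqz (a * b) := by
  ext i j; fin_cases i <;> fin_cases j <;> simp [sqz, mul_comm]

lemma sqz_one : sqz 1 = 1 := by
  ext i j; fin_cases i <;> fin_cases j <;> simp [sqz]

lemma sqz_tr (a : ℝ) : (sqz a)ᵀ = sqz a := by
  ext i j; fin_cases i <;> fin_cases j <;> simp [sqz]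

lemma sqz_det {a : ℝ} (h : a ≠ 0) : (sqz a).det = 1 := by
  simp [sqz, det_fin_two, h]

lemma exists_kak {m : ℕ} (T : Mt m) (hT : IsSymplectic T) :
    ∃ (U V : Mt m) (d : Fin m → ℝ), (∀ k, 0 < d k) ∧ (IsSymplectic U ∧ U * Uᵀ = 1) ∧
      (IsSymplectic V ∧ V * Vᵀ = 1) ∧ T = Uᵀ * blockDiagonal (fun k => sqz (d k)) * V := by
  obtain ⟨U, c, hc, hU, hU1, hD⟩ := exists_diag (T * Tᵀ) (by simp) (hT.mul hT.tr)
  have hpos : ∀ k, 0 < c k := by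
    intro k
    refine lt_of_le_of_ne ?_ (hc k).symm
    have h := congrFun (congrFun hD (0, k)) (0, k)
    have h2 : U * (T * Tᵀ) * Uᵀ = (U * T) * (U * T)ᵀ := by
      rw [transpose_mul]; simp only [Matrix.mul_assoc]
    rw [h2, Matrix.mul_apply, blockDiagonal_apply] at h
    simp only [sqz, if_true] at h
    simp at h
    rw [← h]
    exact Finset.sum_nonneg fun i _ => mul_self_nonneg _
  have hs : ∀ k, Real.sqrt (c k) ≠ 0 := fun k => (Real.sqrt_pos.2 (hpos k)).ne'
  have hV : (blockDiagonal (fun k => sqz (Real.sqrt (c k))⁻¹) * U * T) *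
      (blockDiagonal (fun k => sqz (Real.sqrt (c k))⁻¹) * U * T)ᵀ = 1 := by
    calc _ = blockDiagonal (fun k => sqz (Real.sqrt (c k))⁻¹) * (U * (T * Tᵀ) * Uᵀ) *
          (blockDiagonal (fun k => sqz (Real.sqrt (c k))⁻¹))ᵀ := by
            simp only [transpose_mul, Matrix.mul_assoc]
      _ = 1 := by
        rw [hD, blockDiagonal_transpose, ← blockDiagonal_mul, ← blockDiagonal_mul,
          ← blockDiagonal_one]
        congr 1; funext k
        rw [sqz_tr, sqz_mul, sqz_mul, Pi.one_apply, ← sqz_one]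
        congr 1
        have := Real.mul_self_sqrt (hpos k).le
        field_simp [hs k]
        nlinarith
  refine ⟨U, _, fun k => Real.sqrt (c k), fun k => Real.sqrt_pos.2 (hpos k), ⟨hU, hU1⟩,
    ⟨((isSymplectic_bd _ fun k => sqz_det (inv_ne_zero (hs k))).mul hU).mul hT, hV⟩, ?_⟩
  have h3 : (blockDiagonal (fun k => sqz (Real.sqrt (c k))) : Mt m) *
      blockDiagonal (fun k => sqz (Real.sqrt (c k))⁻¹) = 1 := by
    rw [← blockDiagonal_mul, ← blockDiagonal_one]
    congr 1; funext k
    rw [sqz_mul, mul_inv_cancel₀ (hs k), sqz_one, Pi.one_apply]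
  calc T = Uᵀ * 1 * U * T := by rw [Matrix.mul_one, mul_eq_one_comm.1 hU1, Matrix.one_mul]
    _ = _ := by rw [← h3]; simp only [Matrix.mul_assoc]

/-- rotation -/
noncomputable def rt (x : ℝ) : Matrix (Fin 2) (Fin 2) ℝ :=
  !![Real.cos x, -Real.sin x; Real.sin x, Real.cos x]

lemma rt_orth (x : ℝ) : rt x * (rt x)ᵀ = 1 := by
  have := Real.sin_sq_add_cos_sq x
  ext i j; fin_cases i <;> fin_cases j <;> simp [rt, Matrix.mul_apply, Fin.sum_univ_two] <;>
    nlinarith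

lemma rt_det (x : ℝ) : (rt x).det = 1 := by
  have := Real.sin_sq_add_cos_sq x
  simp [rt, det_fin_two]; nlinarith

lemma rt_neg (x : ℝ) : rt (-x) = (rt x)ᵀ := by
  ext i j; fin_cases i <;> fin_cases j <;> simp [rt]

lemma rt_neg_mul (x : ℝ) : rt (-x) * rt x = 1 := by
  rw [rt_neg]; exact mul_eq_one_comm.1 (rt_orth x)

lemma rt_mul_neg (x : ℝ) : rt x * rt (-x) = 1 := by
  rw [rt_neg]; exact rt_orth x

lemma rt_flip (r : ℝ) : rt (Real.pi / 2) * sqz r * rt (-(Real.pi / 2)) = sqz r⁻¹ := by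
  ext i j; fin_cases i <;> fin_cases j <;>
    simp [rt, sqz, Matrix.mul_apply, Fin.sum_univ_two]

lemma svd_two (a b c d : ℝ) (h : a * d - b * c = 1) :
    ∃ u v s : ℝ, 1 ≤ s ∧ !![a, b; c, d] = rt u * sqz s * rt v ∧
      s ^ 2 + s⁻¹ ^ 2 = a ^ 2 + b ^ 2 + c ^ 2 + d ^ 2 := by
  have polar : ∀ p q : ℝ, ∃ ρ x : ℝ, 0 ≤ ρ ∧ p = ρ * Real.cos x ∧ q = ρ * Real.sin x := by
    intro p q
    refine ⟨‖(⟨p, q⟩ : ℂ)‖, Complex.arg ⟨p, q⟩, norm_nonneg _, ?_, ?_⟩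
    · rw [Complex.norm_mul_cos_arg]
    · rw [Complex.norm_mul_sin_arg]
  obtain ⟨ρ, x, hρ, h1, h2⟩ := polar ((a + d) / 2) ((c - b) / 2)
  obtain ⟨τ, y, hτ, h3, h4⟩ := polar ((a - d) / 2) ((b + c) / 2)
  obtain ⟨u, v, rfl, rfl⟩ : ∃ u v, x = u + v ∧ y = u - v :=
    ⟨(x + y) / 2, (x - y) / 2, by ring, by ring⟩
  have e1 := Real.sin_sq_add_cos_sq (u + v)
  have e2 := Real.sin_sq_add_cos_sq (u - v)
  have hρ2 : ρ ^ 2 = ((a + d) / 2) ^ 2 + ((c - b) / 2) ^ 2 := by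
    rw [h1, h2]; linear_combination (-ρ ^ 2) * e1
  have hτ2 : τ ^ 2 = ((a - d) / 2) ^ 2 + ((b + c) / 2) ^ 2 := by
    rw [h3, h4]; linear_combination (-τ ^ 2) * e2
  have hdet : (ρ + τ) * (ρ - τ) = 1 := by nlinarith
  have hρ1 : 1 ≤ ρ := by nlinarith
  have hinv : (ρ + τ)⁻¹ = ρ - τ := inv_eq_of_mul_eq_one_right hdet
  refine ⟨u, v, ρ + τ, by linarith, ?_, ?_⟩
  · rw [Real.cos_add] at h1
    rw [Real.sin_add] at h2
    rw [Real.cos_sub] at h3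
    rw [Real.sin_sub] at h4
    ext i j; fin_cases i <;> fin_cases j <;>
      simp [rt, sqz, hinv, Matrix.mul_apply, Fin.sum_univ_two]
    · linear_combination h1 + h3
    · linear_combination h4 - h2
    · linear_combination h4 + h2
    · linear_combination h1 - h3
  · rw [hinv]; nlinarith

lemma sqz_mem (N : Submonoid (Matrix (Fin 2) (Fin 2) ℝ)) (hN : ∀ x, rt x ∈ N) (r : ℝ)
    (hr : 0 < r) (hr1 : r ≠ 1) (hrN : sqz r ∈ N) (t : ℝ) (ht : 0 < t) : sqz t ∈ N := by
  have hinv : ∀ r, sqz r ∈ N → sqz r⁻¹ ∈ N := fun r h => by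
    rw [← rt_flip]; exact N.mul_mem (N.mul_mem (hN _) h) (hN _)
  wlog h1 : 1 < r generalizing r with H
  · exact H r⁻¹ (inv_pos.2 hr) (by simpa using hr1) (hinv r hrN)
      ((one_lt_inv₀ hr).2 (lt_of_le_of_ne (not_lt.1 h1) hr1))
  wlog ht1 : 1 ≤ t generalizing t with H
  · have := hinv _ (H t⁻¹ (inv_pos.2 ht) ((one_le_inv₀ ht).2 (not_le.1 ht1).le))
    rwa [inv_inv] at this
  have small : ∀ σ, 1 ≤ σ → σ ≤ r ^ 2 → sqz σ ∈ N := by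
    intro σ hσ hσr
    have hσi : σ⁻¹ ≤ 1 := inv_le_one_of_one_le₀ hσ
    have hσ0 : σ * σ⁻¹ = 1 := mul_inv_cancel₀ (by linarith)
    have hri : r⁻¹ < 1 := inv_lt_one_of_one_lt₀ h1
    have hr0 : r * r⁻¹ = 1 := mul_inv_cancel₀ (by linarith)
    have hrp : 0 < r⁻¹ := inv_pos.2 hr
    have hσr' : r⁻¹ ^ 2 ≤ σ⁻¹ := by
      rw [inv_pow]; exact inv_anti₀ (by linarith) hσr
    have hden : 0 < r ^ 2 - r⁻¹ ^ 2 := by nlinarith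
    set q := (σ - σ⁻¹) / (r ^ 2 - r⁻¹ ^ 2) with hq
    have hq0 : 0 ≤ q := div_nonneg (by linarith) hden.le
    have hq1 : q ≤ 1 := by rw [hq, div_le_one hden]; linarith
    have hqm : q * (r ^ 2 - r⁻¹ ^ 2) = σ - σ⁻¹ := div_mul_cancel₀ _ hden.ne'
    have hcos := Real.cos_arccos (by linarith) hq1
    have hsc := Real.sin_sq_add_cos_sq (Real.arccos q)
    have hA : sqz r * rt (Real.arccos q) * sqz r =
        !![r ^ 2 * q, -Real.sin (Real.arccos q); Real.sin (Real.arccos q), r⁻¹ ^ 2 * q] := by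
      ext i j; fin_cases i <;> fin_cases j <;>
        simp only [rt, sqz, Matrix.mul_apply, Fin.sum_univ_two, hcos] <;> simp <;> field_simp
    generalize Real.sin (Real.arccos q) = w at *
    rw [hcos] at hsc
    have hrr : r ^ 2 * r⁻¹ ^ 2 = 1 := by rw [← mul_pow, hr0, one_pow]
    obtain ⟨u, v, s, hs, hdec, hsum⟩ := svd_two (r ^ 2 * q) (-w) w (r⁻¹ ^ 2 * q)
      (by linear_combination hsc + q ^ 2 * hrr)
    have hsi : s * s⁻¹ = 1 := mul_inv_cancel₀ (by linarith)
    have hsil : s⁻¹ ≤ 1 := inv_le_one_of_one_le₀ hs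
    have hsσ : (s - s⁻¹) ^ 2 = (σ - σ⁻¹) ^ 2 := by
      rw [← hqm]
      linear_combination hsum + 2 * hsc - 2 * hsi + 2 * q ^ 2 * hrr
    have h5 : s - s⁻¹ = σ - σ⁻¹ :=
      (sq_eq_sq₀ (by linarith) (by linarith)).1 hsσ
    have h6 : s = σ := by
      have h7 : (s - σ) * (1 + s * σ) = 0 := by
        have : (s - s⁻¹) * (s * σ) = (σ - σ⁻¹) * (s * σ) := by rw [h5]
        linear_combination this + σ * hsi - s * hσ0
      rcases mul_eq_zero.1 h7 with h | h
      · linarith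
      · nlinarith
    subst h6
    have : sqz s = rt (-u) * (sqz r * rt (Real.arccos q) * sqz r) * rt (-v) := by
      rw [hA, hdec]
      calc sqz s = (rt (-u) * rt u) * sqz s * (rt v * rt (-v)) := by
            rw [rt_neg_mul, rt_mul_neg, Matrix.one_mul, Matrix.mul_one]
        _ = _ := by simp only [Matrix.mul_assoc]
    rw [this]
    exact N.mul_mem (N.mul_mem (hN _) (N.mul_mem (N.mul_mem hrN (hN _)) hrN)) (hN _)
  have hlr : 0 < Real.log (r ^ 2) := Real.log_pos (by nlinarith)
  obtain ⟨n, hn⟩ := exists_nat_gt (Real.log t / Real.log (r ^ 2))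
  have hlt : 0 ≤ Real.log t := Real.log_nonneg ht1
  have hn0 : (0 : ℝ) < n := lt_of_le_of_lt (div_nonneg hlt hlr.le) hn
  have hsm := small (Real.exp (Real.log t / n)) (Real.one_le_exp (div_nonneg hlt hn0.le)) (by
    rw [← Real.le_log_iff_exp_le (by positivity), div_le_iff₀ hn0]
    rw [div_lt_iff₀ hlr] at hn
    linarith)
  have hpow : ∀ (a : ℝ) (k : ℕ), sqz a ^ k = sqz (a ^ k) := by
    intro a k
    induction k with
    | zero => simp [sqz_one]
    | succ k ih => rw [pow_succ, ih, sqz_mul, pow_succ]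
  have := N.pow_mem hsm n
  rw [hpow, ← Real.exp_nat_mul, mul_div_cancel₀ _ hn0.ne', Real.exp_log ht] at this
  exact this

lemma exists_swapMat {m : ℕ} (k0 k : Fin m) : ∃ Q : Mt m, IsSymplectic Q ∧ Q * Qᵀ = 1 ∧
    ∀ A : Fin m → Matrix (Fin 2) (Fin 2) ℝ,
      Q * blockDiagonal A * Qᵀ = blockDiagonal (fun j => A (Equiv.swap k0 k j)) := by
  let σ : Fin 2 × Fin m ≃ Fin 2 × Fin m := (Equiv.refl _).prodCongr (Equiv.swap k0 k)
  let Q : Mt m := (1 : Mt m).submatrix σ id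
  have hQ : ∀ A : Fin m → Matrix (Fin 2) (Fin 2) ℝ,
      Q * blockDiagonal A * Qᵀ = blockDiagonal (fun j => A (Equiv.swap k0 k j)) := by
    intro A
    have h1 : Q * blockDiagonal A = (blockDiagonal A).submatrix σ id := by
      have := submatrix_mul (1 : Mt m) (blockDiagonal A) σ id id Function.bijective_id
      rw [Matrix.one_mul] at this
      exact this.symm
    have h2 : (blockDiagonal A : Mt m).submatrix σ id * Qᵀ = (blockDiagonal A).submatrix σ σ := by
      have := submatrix_mul (blockDiagonal A : Mt m) 1 σ id σ Function.bijective_id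
      rw [Matrix.mul_one] at this
      simp only [Q, transpose_submatrix, transpose_one]
      exact this.symm
    rw [h1, h2]
    ext ⟨i, j⟩ ⟨i', j'⟩
    simp [σ, blockDiagonal_apply]
  refine ⟨Q, hQ _, ?_, hQ⟩
  have := hQ 1
  rw [blockDiagonal_one, Matrix.mul_one] at this
  rw [this]; exact blockDiagonal_one

lemma submonoid_full {m : ℕ} (H : Submonoid (Mt m))
    (hK : ∀ T : Mt m, IsSymplectic T → T * Tᵀ = 1 → T ∈ H)
    (S : Mt m) (hS : IsSymplectic S) (hSn : ¬ S * Sᵀ = 1) (hSH : S ∈ H)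
    (T : Mt m) (hT : IsSymplectic T) : T ∈ H := by
  have hKt : ∀ T : Mt m, IsSymplectic T → T * Tᵀ = 1 → Tᵀ ∈ H := fun T h h' =>
    hK _ h.tr (by rw [transpose_transpose]; exact mul_eq_one_comm.1 h')
  obtain ⟨N, hN⟩ : ∃ N : Submonoid (Fin m → Matrix (Fin 2) (Fin 2) ℝ),
      ∀ A, A ∈ N ↔ blockDiagonal A ∈ H :=
    ⟨{ carrier := {A | blockDiagonal A ∈ H}
       mul_mem' := fun {A B} hA hB => by
        have h := H.mul_mem hA hB
        rw [← blockDiagonal_mul] at h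
        exact h
       one_mem' := by
        have h := H.one_mem
        rw [← blockDiagonal_one] at h
        exact h }, fun A => Iff.rfl⟩
  have hrot : ∀ x : Fin m → ℝ, (fun k => rt (x k)) ∈ N := fun x => (hN _).2 <|
    hK _ (isSymplectic_bd _ fun k => rt_det _) (orth_bd _ fun k => rt_orth _)
  obtain ⟨U, V, d, hd, hU, hV, hdec⟩ := exists_kak S hS
  have hdN : (fun k => sqz (d k)) ∈ N := by
    have : (blockDiagonal (fun k => sqz (d k)) : Mt m) = U * S * Vᵀ := by
      rw [hdec]
      calc _ = (U * Uᵀ) * (blockDiagonal (fun k => sqz (d k)) : Mt m) * (V * Vᵀ) := by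
            rw [hU.2, hV.2, Matrix.one_mul, Matrix.mul_one]
        _ = _ := by simp only [Matrix.mul_assoc]
    rw [hN, this]
    exact H.mul_mem (H.mul_mem (hK _ hU.1 hU.2) hSH) (hKt _ hV.1 hV.2)
  obtain ⟨k0, hk0⟩ : ∃ k, d k ≠ 1 := by
    by_contra! hcon
    apply hSn
    have : (blockDiagonal (fun k => sqz (d k)) : Mt m) = 1 := by
      rw [← blockDiagonal_one]; congr 1; funext k; rw [hcon, sqz_one, Pi.one_apply]
    rw [hdec, this, Matrix.mul_one, transpose_mul, transpose_transpose]
    calc Uᵀ * V * (Vᵀ * U) = Uᵀ * (V * Vᵀ) * U := by simp only [Matrix.mul_assoc]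
      _ = 1 := by rw [hV.2, Matrix.mul_one]; exact mul_eq_one_comm.1 hU.2
  have hone : Pi.mulSingle k0 (sqz (d k0 * d k0)) ∈ N := by
    let x : Fin m → ℝ := fun k => if k = k0 then 0 else Real.pi / 2
    have h1 := N.mul_mem hdN (N.mul_mem (N.mul_mem (hrot x) hdN) (hrot (fun k => - x k)))
    convert h1 using 1
    funext k
    by_cases hk : k = k0
    · subst hk
      simp [x, rt, sqz_mul, ← Matrix.one_fin_two]
    · simp only [Pi.mulSingle_eq_of_ne hk, Pi.mul_apply, x, if_neg hk, rt_flip, sqz_mul]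
      rw [mul_inv_cancel₀ (hd k).ne', sqz_one]
  have hk0N : ∀ t, 0 < t → Pi.mulSingle k0 (sqz t) ∈ N := by
    intro t ht
    refine sqz_mem (N.comap (MonoidHom.mulSingle (fun _ : Fin m => Matrix (Fin 2) (Fin 2) ℝ) k0))
      ?_ (d k0 * d k0) (mul_pos (hd _) (hd _)) ?_ hone t ht
    · intro x
      have := hrot (fun k => if k = k0 then x else 0)
      change Pi.mulSingle k0 (rt x) ∈ N
      convert this using 1
      funext k
      by_cases hk : k = k0
      · subst hk; simp
      · simp [hk, rt, ← Matrix.one_fin_two]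
    · intro h
      apply hk0
      have := hd k0
      nlinarith
  have hall : ∀ k t, 0 < t → Pi.mulSingle k (sqz t) ∈ N := by
    intro k t ht
    obtain ⟨Q, hQs, hQo, hQ⟩ := exists_swapMat k0 k
    have := H.mul_mem (H.mul_mem (hK Q hQs hQo) ((hN _).1 (hk0N t ht))) (hKt Q hQs hQo)
    rw [hQ] at this
    rw [hN]
    convert this using 2
    funext j
    by_cases hj : j = k
    · subst hj; simp
    · rw [Pi.mulSingle_eq_of_ne hj, Pi.mulSingle_eq_of_ne]
      intro h
      apply hj
      rw [Equiv.swap_apply_eq_iff, Equiv.swap_apply_left] at h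
      exact h
  obtain ⟨U, V, d, hd, hU, hV, hdec⟩ := exists_kak T hT
  have : (fun k => sqz (d k)) ∈ N := Submonoid.pi_mem_of_mulSingle_mem _ fun k => hall k _ (hd k)
  rw [hdec]
  exact H.mul_mem (H.mul_mem (hKt _ hU.1 hU.2) ((hN _).1 this)) (hK _ hV.1 hV.2)

end helpers

/-- **Dense generation of the symplectic group.**
If a finite set `K` of orthogonal symplectic matrices generates a dense subgroup of the
orthogonal symplectic group, then adjoining any non-orthogonal symplectic matrix `S` gives
a subgroup that is dense in all of `Sp_{2m}(ℝ)`. -/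
theorem dense_subgroup_symplectic_of_dense_orthogonal
    (m : ℕ) (hm : 1 ≤ m)
    (K : Set (Matrix (Fin 2 × Fin m) (Fin 2 × Fin m) ℝ))
    (hKfin : K.Finite)
    (hKmem : ∀ A ∈ K, IsSymplectic A ∧ A * Aᵀ = 1)
    (hKdense : ∀ T : Matrix (Fin 2 × Fin m) (Fin 2 × Fin m) ℝ,
      IsSymplectic T → T * Tᵀ = 1 →
      T ∈ closure ((Submonoid.closure (K ∪ (Inv.inv '' K)) :
        Submonoid (Matrix (Fin 2 × Fin m) (Fin 2 × Fin m) ℝ)) : Set _))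
    (S : Matrix (Fin 2 × Fin m) (Fin 2 × Fin m) ℝ)
    (hS : IsSymplectic S) (hSnotOrth : ¬ (S * Sᵀ = 1)) :
    ∀ T : Matrix (Fin 2 × Fin m) (Fin 2 × Fin m) ℝ, IsSymplectic T →
      T ∈ closure ((Submonoid.closure ((K ∪ (Inv.inv '' K)) ∪ {S, S⁻¹}) :
        Submonoid (Matrix (Fin 2 × Fin m) (Fin 2 × Fin m) ℝ)) : Set _) := by
  intro T hT
  have hsub : ((Submonoid.closure (K ∪ (Inv.inv '' K)) : Submonoid (Mt m)) : Set (Mt m)) ⊆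
      ((Submonoid.closure ((K ∪ (Inv.inv '' K)) ∪ {S, S⁻¹}) : Submonoid (Mt m)) : Set (Mt m)) :=
    Submonoid.closure_mono Set.subset_union_left
  exact submonoid_full
    (Submonoid.closure ((K ∪ (Inv.inv '' K)) ∪ {S, S⁻¹}) : Submonoid (Mt m)).topologicalClosure
    (fun A h h' => closure_mono hsub (hKdense A h h')) S hS hSnotOrth
    (subset_closure (Submonoid.subset_closure (Or.inr (Or.inl rfl)))) T hT
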